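/- Let S be an AG-groupoid with a zero element 0 (0·s = s·0 = 0 for all s ∈ S), let P_S be the set of all proper prime ideals of S, and for each ideal I of S let Θ_I = {J ∈ P_S : I ⊄ J}. Then the collection Γ(P_S) = {Θ_I : I an ideal of S} is the collection of open sets of a topology on P_S; that is, there exists a topology on P_S whose open sets are exactly the sets Θ_I for I an ideal of S. -/

import Mathlib

open Pointwise

/-- An ideal of an AG-groupoid `S` is a subset `I` with `I·S ⊆ I` and `S·I ⊆ I`. -/
def IsIdeal {S : Type*} [Mul S] (I : Set S) : Prop :=
  I * (Set.univ : Set S) ⊆ I ∧ (Set.univ : Set S) * I ⊆ I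

/-- An ideal `P` is prime if `A·B ⊆ P` implies `A ⊆ P` or `B ⊆ P` for all ideals
`A`, `B`. -/
def IsPrimeIdeal {S : Type*} [Mul S] (P : Set S) : Prop :=
  IsIdeal P ∧ ∀ A B : Set S, IsIdeal A → IsIdeal B → A * B ⊆ P → A ⊆ P ∨ B ⊆ P

/-- `P_S`: the set of proper prime ideals of `S`, as a type. -/
def PrimeSpectrum' (S : Type*) [Mul S] : Type _ :=
  {J : Set S // IsPrimeIdeal J ∧ J ≠ Set.univ}

theorem isIdeal_univ {S : Type*} [Mul S] : IsIdeal (Set.univ : Set S) :=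
  ⟨Set.subset_univ _, Set.subset_univ _⟩

theorem IsIdeal.inter {S : Type*} [Mul S] {A B : Set S} (hA : IsIdeal A) (hB : IsIdeal B) :
    IsIdeal (A ∩ B) :=
  ⟨Set.subset_inter ((Set.mul_subset_mul_right Set.inter_subset_left).trans hA.1)
      ((Set.mul_subset_mul_right Set.inter_subset_right).trans hB.1),
    Set.subset_inter ((Set.mul_subset_mul_left Set.inter_subset_left).trans hA.2)
      ((Set.mul_subset_mul_left Set.inter_subset_right).trans hB.2)⟩

theorem IsIdeal.sUnion {S : Type*} [Mul S] {C : Set (Set S)} (hC : ∀ I ∈ C, IsIdeal I) :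
    IsIdeal (⋃₀ C) := by
  constructor
  · rintro _ ⟨a, ⟨I, hI, ha⟩, b, hb, rfl⟩
    exact ⟨I, hI, (hC I hI).1 (Set.mul_mem_mul ha hb)⟩
  · rintro _ ⟨a, ha, b, ⟨I, hI, hb⟩, rfl⟩
    exact ⟨I, hI, (hC I hI).2 (Set.mul_mem_mul ha hb)⟩

theorem IsIdeal.mul_subset_inter {S : Type*} [Mul S] {A B : Set S} (hA : IsIdeal A)
    (hB : IsIdeal B) : A * B ⊆ A ∩ B :=
  Set.subset_inter ((Set.mul_subset_mul_left (Set.subset_univ _)).trans hA.1)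
    ((Set.mul_subset_mul_right (Set.subset_univ _)).trans hB.2)

theorem IsPrimeIdeal.inter_subset_iff {S : Type*} [Mul S] {A B P : Set S} (hP : IsPrimeIdeal P)
    (hA : IsIdeal A) (hB : IsIdeal B) : A ∩ B ⊆ P ↔ A ⊆ P ∨ B ⊆ P :=
  ⟨fun h => hP.2 A B hA hB ((hA.mul_subset_inter hB).trans h),
    fun h => h.elim Set.inter_subset_left.trans Set.inter_subset_right.trans⟩

/-- Let `S` be an AG-groupoid with zero element `z`, let `P_S` be the set of proper
prime ideals of `S`, and for each ideal `I` let `Θ_I = {J ∈ P_S : I ⊄ J}`. Then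
`Γ(P_S) = {Θ_I : I an ideal}` is the collection of open sets of a topology on
`P_S`. -/
theorem prime_ideal_topology {S : Type*} [Mul S]
    (hinv : ∀ a b c : S, (a * b) * c = (c * b) * a)
    (z : S) (hz : ∀ s : S, z * s = z ∧ s * z = z) :
    ∃ T : TopologicalSpace (PrimeSpectrum' S),
      ∀ U : Set (PrimeSpectrum' S),
        T.IsOpen U ↔ ∃ I : Set S, IsIdeal I ∧ U = {J : PrimeSpectrum' S | ¬ I ⊆ J.1} := by
  refine ⟨{
    IsOpen := fun U => ∃ I : Set S, IsIdeal I ∧ U = {J : PrimeSpectrum' S | ¬ I ⊆ J.1}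
    isOpen_univ := ⟨Set.univ, isIdeal_univ, ?_⟩
    isOpen_inter := ?_
    isOpen_sUnion := ?_ }, fun U => Iff.rfl⟩
  · ext J
    simpa [Set.univ_subset_iff] using J.2.2
  · rintro _ _ ⟨A, hA, rfl⟩ ⟨B, hB, rfl⟩
    refine ⟨A ∩ B, hA.inter hB, ?_⟩
    ext J
    exact not_or.symm.trans (not_congr (J.2.1.inter_subset_iff hA hB).symm)
  · intro C hC
    choose! I hI hU using hC
    refine ⟨⋃₀ (I '' C), IsIdeal.sUnion (Set.forall_mem_image.2 hI), ?_⟩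
    ext J
    have key : ∀ U ∈ C, (J ∈ U ↔ ¬ I U ⊆ J.1) := fun U h => by
      conv_lhs => rw [hU U h]
      rfl
    simp only [Set.mem_sUnion, Set.mem_ofPred_eq, Set.sUnion_subset_iff, Set.forall_mem_image,
      not_forall, exists_prop]
    exact exists_congr fun U => and_congr_right (key U)
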